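/- arXiv:1606.00978 — 2 statements merged into one kernel-verified Lean document; each statement's English description precedes it below -/
import Mathlib

section
/- (Two-component model, XXZ case.) Let H be a complex vector space and for j = 1, 2 let Tⱼ(λ) = [[Aⱼ(λ),Bⱼ(λ)],[Cⱼ(λ),Dⱼ(λ)]] be monodromy matrices on H with common domain Λ ⊆ ℂ, each satisfying the RTT relation with the trigonometric (XXZ-type) R-matrix with anisotropy η, such that every matrix entry of T₁(λ) commutes with every matrix entry of T₂(μ). Suppose there is a nonzero vector |0⟩ ∈ H and scalar functions aⱼ, dⱼ : Λ → ℂ with Aⱼ(λ)|0⟩ = aⱼ(λ)|0⟩, Dⱼ(λ)|0⟩ = dⱼ(λ)|0⟩ and Cⱼ(λ)|0⟩ = 0 for j = 1,2 and all λ ∈ Λ. Let B(λ) = A₁(λ)B₂(λ) + B₁(λ)D₂(λ) be the (1,2) entry of T(λ) = T₁(λ)T₂(λ). Then for any λ₁, …, λ_M ∈ Λ with sinh(λⱼ−λ_k) ≠ 0 for all j ≠ k: B(λ₁)⋯B(λ_M)|0⟩ = Σ_{J ⊆ {1,…,M}} ( ∏_{j∈J, k∉J} f(λⱼ,λ_k)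 ) ( ∏_{j∈J} d₂(λⱼ) ) ( ∏_{k∉J} a₁(λ_k) ) ( ∏_{j∈J} B₁(λⱼ) ) ( ∏_{k∉J} B₂(λ_k) ) |0⟩, where f(λ,μ) = sinh(λ−μ+η)/sinh(λ−μ), the sum is over all subsets J of {1,…,M}, and the products of B₁-operators (respectively B₂-operators) may be taken in any order since [Bⱼ(λ),Bⱼ(μ)] = 0. -/
open scoped BigOperators

noncomputable section

/-- The endomorphism algebra of a complex vector space `H`. -/
abbrev EndH (H : Type) [AddCommGroup H] [Module ℂ H] := Module.End ℂ H

/-- The 4×4 matrix `[[f,0,0,0],[0,1,g,0],[0,g,1,0],[0,0,0,f]]` acting on `ℂ² ⊗ ℂ²`,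
indexed by `Fin 2 × Fin 2` (standard tensor basis). -/
def Rfg (f g : ℂ) : Matrix (Fin 2 × Fin 2) (Fin 2 × Fin 2) ℂ :=
  fun p q =>
    if p = q then (if p.1 = p.2 then f else 1)
    else if p.1 = q.2 ∧ p.2 = q.1 then g else 0

/-- Rational function `f(λ,μ) = (λ-μ+1)/(λ-μ)`. -/
def fXXX (l m : ℂ) : ℂ := (l - m + 1) / (l - m)

/-- Rational function `g(λ,μ) = 1/(λ-μ)`. -/
def gXXX (l m : ℂ) : ℂ := 1 / (l - m)

/-- The rational (XXX-type) R-matrix. -/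
def RXXX (l m : ℂ) : Matrix (Fin 2 × Fin 2) (Fin 2 × Fin 2) ℂ := Rfg (fXXX l m) (gXXX l m)

/-- Trigonometric `f(λ,μ) = sinh(λ-μ+η)/sinh(λ-μ)`. -/
def fXXZ (η l m : ℂ) : ℂ := Complex.sinh (l - m + η) / Complex.sinh (l - m)

/-- Trigonometric `g(λ,μ) = sinh η / sinh(λ-μ)`. -/
def gXXZ (η l m : ℂ) : ℂ := Complex.sinh η / Complex.sinh (l - m)

/-- The trigonometric (XXZ-type) R-matrix with anisotropy `η`. -/
def RXXZ (η l m : ℂ) : Matrix (Fin 2 × Fin 2) (Fin 2 × Fin 2) ℂ :=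
  Rfg (fXXZ η l m) (gXXZ η l m)

variable {H : Type} [AddCommGroup H] [Module ℂ H]

/-- `T₁(λ)`: the 2×2 operator matrix `T` acting in the first auxiliary space `ℂ²`
(and in `H`), identity in the second auxiliary space. -/
def aux1 (T : Matrix (Fin 2) (Fin 2) (EndH H)) :
    Matrix (Fin 2 × Fin 2) (Fin 2 × Fin 2) (EndH H) :=
  fun p q => if p.2 = q.2 then T p.1 q.1 else 0

/-- `T₂(μ)`: the 2×2 operator matrix `T` acting in the second auxiliary space `ℂ²`
(and in `H`), identity in the first auxiliary space. -/
def aux2 (T : Matrix (Fin 2) (Fin 2) (EndH H)) :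
    Matrix (Fin 2 × Fin 2) (Fin 2 × Fin 2) (EndH H) :=
  fun p q => if p.1 = q.1 then T p.2 q.2 else 0

/-- A scalar 4×4 matrix viewed as a matrix of endomorphisms of `H`
(i.e. `R ⊗ id_H` on `ℂ² ⊗ ℂ² ⊗ H`). -/
def embedR (R : Matrix (Fin 2 × Fin 2) (Fin 2 × Fin 2) ℂ) :
    Matrix (Fin 2 × Fin 2) (Fin 2 × Fin 2) (EndH H) :=
  R.map (fun c => c • (1 : EndH H))

/-- The RTT relation `R₁₂(λ,μ) T₁(λ) T₂(μ) = T₂(μ) T₁(λ) R₁₂(λ,μ)` in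
`End(ℂ² ⊗ ℂ² ⊗ H)`, for all `λ, μ ∈ Λ` which are admissible (`adm λ μ`). -/
def SatisfiesRTT (Λ : Set ℂ) (adm : ℂ → ℂ → Prop)
    (R : ℂ → ℂ → Matrix (Fin 2 × Fin 2) (Fin 2 × Fin 2) ℂ)
    (T : ℂ → Matrix (Fin 2) (Fin 2) (EndH H)) : Prop :=
  ∀ lam mu : ℂ, lam ∈ Λ → mu ∈ Λ → adm lam mu →
    embedR (R lam mu) * aux1 (T lam) * aux2 (T mu)
      = aux2 (T mu) * aux1 (T lam) * embedR (R lam mu)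

/-- Ordered product `∏_{k ∈ s} B k` of endomorphisms indexed by a finset of a linearly
ordered type, taken in increasing order of the index. -/
def finsetOpProd {ι : Type} [LinearOrder ι] (s : Finset ι) (B : ι → EndH H) : EndH H :=
  ((s.sort (· ≤ ·)).map B).prod


theorem finsetOpProd_empty {ι : Type} [LinearOrder ι] (B : ι → EndH H) :
    finsetOpProd ∅ B = 1 := by
  simp [finsetOpProd]

theorem finsetOpProd_insert_of_lt {ι : Type} [LinearOrder ι] (B : ι → EndH H) {a : ι}
    {s : Finset ι} (h : ∀ x ∈ s, a < x) :
    finsetOpProd (insert a s) B = B a * finsetOpProd s B := by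
  unfold finsetOpProd
  rw [Finset.sort_insert (r := (· ≤ ·)) (fun b hb => (h b hb).le)
    (fun ha => lt_irrefl _ (h a ha))]
  simp

theorem finsetOpProd_univ_fin {M : ℕ} (B : Fin M → EndH H) :
    finsetOpProd Finset.univ B = (List.ofFn B).prod := by
  unfold finsetOpProd
  rw [Fin.sort_univ, List.ofFn_eq_map]

theorem Commute.finsetOpProd_right {ι : Type} [LinearOrder ι] {X : EndH H} {B : ι → EndH H}
    (h : ∀ i, Commute X (B i)) (s : Finset ι) : Commute X (finsetOpProd s B) := by
  apply Commute.list_prod_right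
  intro y hy
  obtain ⟨i, -, rfl⟩ := List.mem_map.1 hy
  exact h i

/-- Off-shell action of a diagonal monodromy entry on an ordered product of creation operators.
Since only `f j i • [B j, B i] = 0` is assumed, this also covers zeros of `f`. -/
theorem apply_finsetOpProd_of_exchange {ι : Type} [LinearOrder ι] {A B : ι → EndH H}
    {f g : ι → ι → ℂ} {a : ι → ℂ} {v : H}
    (hAB : ∀ i j, i ≠ j → ∀ x, A i (B j x) = f j i • B j (A i x) - g j i • B i (A j x))
    (hBB : ∀ i j, i ≠ j → ∀ x, f j i • B j (B i x) = f j i • B i (B j x))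
    (hfg : ∀ i j k, i ≠ j → i ≠ k → j ≠ k →
      f j i * g k i - g j i * g k j = g k i * f j k)
    (hv : ∀ i, A i v = a i • v) (s : Finset ι) :
    ∀ i, i ∉ s → A i (finsetOpProd s B v) =
      ((∏ j ∈ s, f j i) * a i) • finsetOpProd s B v -
        ∑ j ∈ s, (g j i * (∏ k ∈ s.erase j, f k j) * a j) •
          B i (finsetOpProd (s.erase j) B v) := by
  induction s using Finset.induction_on_min with
  | empty => intro i _; simp [finsetOpProd_empty, hv]
  | insert m s hm ih =>
    intro i hi
    have hms : m ∉ s := fun h => lt_irrefl _ (hm m h)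
    have him : i ≠ m := fun h => hi (h ▸ Finset.mem_insert_self _ _)
    have his : i ∉ s := fun h => hi (Finset.mem_insert_of_mem h)
    have herase : ∀ j ∈ s, (insert m s).erase j = insert m (s.erase j) := fun j hj =>
      Finset.erase_insert_of_ne fun h => hms (h ▸ hj)
    rw [finsetOpProd_insert_of_lt B hm, Finset.sum_insert hms, Finset.prod_insert hms,
      Finset.erase_insert hms, Module.End.mul_apply, hAB i m him, ih i his, ih m hms]
    have hsum : ∑ j ∈ s, (g j i * (∏ k ∈ (insert m s).erase j, f k j) * a j) •
          B i (finsetOpProd ((insert m s).erase j) B v) =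
        f m i • B m (∑ j ∈ s, (g j i * (∏ k ∈ s.erase j, f k j) * a j) •
          B i (finsetOpProd (s.erase j) B v)) -
        g m i • B i (∑ j ∈ s, (g j m * (∏ k ∈ s.erase j, f k j) * a j) •
          B m (finsetOpProd (s.erase j) B v)) := by
      simp only [map_sum, Finset.smul_sum, map_smul]
      rw [← Finset.sum_sub_distrib]
      refine Finset.sum_congr rfl fun j hj => ?_
      have hmj : m ≠ j := fun h => hms (h ▸ hj)
      have hij : i ≠ j := fun h => his (h ▸ hj)
      have hm' : m ∉ s.erase j := fun h => hms (Finset.mem_of_mem_erase h)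
      rw [herase j hj, Finset.prod_insert hm',
        finsetOpProd_insert_of_lt B (fun x hx => hm x (Finset.mem_of_mem_erase hx)),
        Module.End.mul_apply, smul_comm (f m i), hBB i m him, smul_smul, smul_smul, ← sub_smul]
      congr 1
      linear_combination (-(∏ k ∈ s.erase j, f k j) * a j) * hfg i m j him hij hmj
    rw [hsum]
    simp only [map_sub, map_smul, smul_sub, smul_smul]
    module

/-- Removing a marked element of a subset and marking an element of the complement are the same. -/
theorem Finset.sum_powerset_sum_erase {ι E : Type*} [DecidableEq ι] [AddCommMonoid E]
    (s : Finset ι) (F : Finset ι → ι → E) :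
    ∑ J ∈ s.powerset, ∑ j ∈ J, F (J.erase j) j = ∑ J ∈ s.powerset, ∑ j ∈ s \ J, F J j := by
  rw [Finset.sum_sigma', Finset.sum_sigma']
  refine Finset.sum_bij' (fun p _ => ⟨p.1.erase p.2, p.2⟩) (fun p _ => ⟨insert p.2 p.1, p.2⟩)
    ?_ ?_ ?_ ?_ ?_
  · rintro ⟨J, j⟩ h
    simp only [Finset.mem_sigma, Finset.mem_powerset, Finset.mem_sdiff] at h ⊢
    exact ⟨(Finset.erase_subset _ _).trans h.1, h.1 h.2, by simp⟩
  · rintro ⟨J, j⟩ h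
    simp only [Finset.mem_sigma, Finset.mem_powerset, Finset.mem_sdiff] at h ⊢
    exact ⟨Finset.insert_subset h.2.1 h.1, by simp⟩
  · rintro ⟨J, j⟩ h
    simp only [Finset.mem_sigma] at h
    simp [Finset.insert_erase h.2]
  · rintro ⟨J, j⟩ h
    simp only [Finset.mem_sigma, Finset.mem_sdiff] at h
    simp [Finset.erase_insert h.2.2]
  · intros; rfl

/-- The two-component expansion, derived from the exchange relations alone. -/
theorem finsetOpProd_two_component {ι : Type} [LinearOrder ι] {A₁ B₁ B₂ D₂ : ι → EndH H}
    {f g : ι → ι → ℂ} {a d : ι → ℂ} {v : H}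
    (hAB : ∀ i j, i ≠ j → ∀ x, A₁ i (B₁ j x) = f j i • B₁ j (A₁ i x) - g j i • B₁ i (A₁ j x))
    (hDB : ∀ i j, i ≠ j → ∀ x, D₂ i (B₂ j x) = f i j • B₂ j (D₂ i x) - g i j • B₂ i (D₂ j x))
    (hBB₁ : ∀ i j, i ≠ j → ∀ x, f i j • B₁ i (B₁ j x) = f i j • B₁ j (B₁ i x))
    (hBB₂ : ∀ i j, i ≠ j → ∀ x, f i j • B₂ i (B₂ j x) = f i j • B₂ j (B₂ i x))
    (hfg₁ : ∀ i j k, i ≠ j → i ≠ k → j ≠ k →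
      f j i * g k i - g j i * g k j = g k i * f j k)
    (hfg₂ : ∀ i j k, i ≠ j → i ≠ k → j ≠ k →
      f i j * g i k - g i j * g j k = g i k * f k j)
    (hg : ∀ i j, g i j = -g j i)
    (hA₁B₂ : ∀ i j, Commute (A₁ i) (B₂ j)) (hB₁B₂ : ∀ i j, Commute (B₁ i) (B₂ j))
    (hD₂B₁ : ∀ i j, Commute (D₂ i) (B₁ j))
    (hA : ∀ i, A₁ i v = a i • v) (hD : ∀ i, D₂ i v = d i • v) (s : Finset ι) :
    finsetOpProd s (fun i => A₁ i * B₂ i + B₁ i * D₂ i) v =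
      ∑ J ∈ s.powerset, ((∏ j ∈ J, ∏ k ∈ s \ J, f j k) * (∏ j ∈ J, d j) * ∏ k ∈ s \ J, a k) •
        finsetOpProd J B₁ (finsetOpProd (s \ J) B₂ v) := by
  have swap : ∀ {X Y : EndH H}, Commute X Y → ∀ x, X (Y x) = Y (X x) := fun h x =>
    LinearMap.congr_fun h.eq x
  have hB₁P : ∀ i s, Commute (B₁ i) (finsetOpProd s B₂) := fun i s =>
    Commute.finsetOpProd_right (hB₁B₂ i) s
  have hB₂P : ∀ i s, Commute (B₂ i) (finsetOpProd s B₁) := fun i s =>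
    Commute.finsetOpProd_right (fun j => (hB₁B₂ j i).symm) s
  have hPP : ∀ s t, Commute (finsetOpProd s B₁) (finsetOpProd t B₂) := fun s t =>
    Commute.finsetOpProd_right (fun j => (hB₂P j s).symm) t
  induction s using Finset.induction_on_min with
  | empty => simp [finsetOpProd_empty]
  | insert m s hm ih =>
    have hms : m ∉ s := fun h => lt_irrefl _ (hm m h)
    rw [finsetOpProd_insert_of_lt _ hm, Module.End.mul_apply, ih, Finset.sum_powerset_insert hms,
      map_sum]
    set c : Finset ι → ℂ := fun J =>
      (∏ j ∈ J, ∏ k ∈ s \ J, f j k) * (∏ j ∈ J, d j) * ∏ k ∈ s \ J, a k with hc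
    set F : Finset ι → ι → H := fun J k =>
      (c J * (g m k * (∏ i ∈ (s \ J).erase k, f k i) * d k)) •
        B₁ m (finsetOpProd J B₁ (B₂ m (finsetOpProd ((s \ J).erase k) B₂ v))) with hF
    have key : ∀ J ∈ s.powerset,
        (A₁ m * B₂ m + B₁ m * D₂ m) (c J • finsetOpProd J B₁ (finsetOpProd (s \ J) B₂ v)) =
        ((((∏ j ∈ J, ∏ k ∈ insert m s \ J, f j k) * (∏ j ∈ J, d j) *
            ∏ k ∈ insert m s \ J, a k) •
          finsetOpProd J B₁ (finsetOpProd (insert m s \ J) B₂ v)) +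
        (((∏ j ∈ insert m J, ∏ k ∈ insert m s \ insert m J, f j k) *
            (∏ j ∈ insert m J, d j) * ∏ k ∈ insert m s \ insert m J, a k) •
          finsetOpProd (insert m J) B₁ (finsetOpProd (insert m s \ insert m J) B₂ v))) +
        (∑ j ∈ J, F (J.erase j) j - ∑ k ∈ s \ J, F J k) := by
      intro J hJ
      have hJs : J ⊆ s := Finset.mem_powerset.1 hJ
      have hmJ : m ∉ J := fun h => hms (hJs h)
      have hmC : m ∉ s \ J := fun h => hms (Finset.mem_sdiff.1 h).1
      have hsd : insert m s \ J = insert m (s \ J) := Finset.insert_sdiff_of_notMem _ hmJ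
      have hsd' : insert m s \ insert m J = s \ J := by
        ext x
        simp only [Finset.mem_sdiff, Finset.mem_insert]
        constructor
        · tauto
        · rintro ⟨h1, h2⟩
          exact ⟨Or.inr h1, fun h => h.elim (fun e => hms (e ▸ h1)) h2⟩
      have hA' := apply_finsetOpProd_of_exchange hAB (fun i j h => hBB₁ j i h.symm) hfg₁ hA J m hmJ
      have hD' := apply_finsetOpProd_of_exchange (f := fun i j => f j i) (g := fun i j => g j i)
        hDB (fun i j h x => (hBB₂ i j h x).symm) hfg₂ hD (s \ J) m hmC
      have hAsum : ∑ j ∈ J, F (J.erase j) j =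
          -(c J • ∑ j ∈ J, (g j m * (∏ k ∈ J.erase j, f k j) * a j) •
            B₂ m (finsetOpProd (s \ J) B₂ (B₁ m (finsetOpProd (J.erase j) B₁ v)))) := by
        rw [Finset.smul_sum, ← Finset.sum_neg_distrib]
        refine Finset.sum_congr rfl fun j hj => ?_
        have hjC : j ∉ s \ J := fun h => (Finset.mem_sdiff.1 h).2 hj
        have hjE : j ∉ J.erase j := Finset.notMem_erase j J
        have hE : s \ J.erase j = insert j (s \ J) := Finset.sdiff_erase (hJs hj)
        have hcJ : c J = (∏ i ∈ J.erase j, ∏ k ∈ s \ J, f i k) * (∏ k ∈ s \ J, f j k) *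
            ((∏ i ∈ J.erase j, d i) * d j) * ∏ k ∈ s \ J, a k := by
          simp only [hc]
          rw [← Finset.mul_prod_erase J _ hj, ← Finset.mul_prod_erase J d hj]
          ring
        have hcE : c (J.erase j) = (∏ i ∈ J.erase j, f i j) *
            (∏ i ∈ J.erase j, ∏ k ∈ s \ J, f i k) *
            (∏ i ∈ J.erase j, d i) * (a j * ∏ k ∈ s \ J, a k) := by
          simp only [hc]
          rw [hE, Finset.prod_insert hjC]
          simp only [Finset.prod_insert hjC, Finset.prod_mul_distrib]
        simp only [hF]
        rw [hcE, hcJ, hE, Finset.erase_insert hjC, hg m j, smul_smul, ← neg_smul,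
          swap (hB₁P m _).symm, swap (hB₁B₂ m m).symm, swap (hPP _ _).symm, swap (hB₂P m _)]
        congr 1
        ring
      have hDsum : ∑ k ∈ s \ J, F J k =
          c J • ∑ k ∈ s \ J, (g m k * (∏ i ∈ (s \ J).erase k, f k i) * d k) •
            B₁ m (finsetOpProd J B₁ (B₂ m (finsetOpProd ((s \ J).erase k) B₂ v))) := by
        simp only [hF, Finset.smul_sum, smul_smul]
      have hAterm : A₁ m (B₂ m (finsetOpProd J B₁ (finsetOpProd (s \ J) B₂ v))) =
          B₂ m (finsetOpProd (s \ J) B₂ (A₁ m (finsetOpProd J B₁ v))) := by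
        rw [swap (hPP _ _), swap (hA₁B₂ m m), swap (Commute.finsetOpProd_right (hA₁B₂ m) _)]
      have hDterm : B₁ m (D₂ m (finsetOpProd J B₁ (finsetOpProd (s \ J) B₂ v))) =
          B₁ m (finsetOpProd J B₁ (D₂ m (finsetOpProd (s \ J) B₂ v))) := by
        rw [swap (Commute.finsetOpProd_right (hD₂B₁ m) _)]
      rw [hAsum, hDsum, hsd, hsd', map_smul, LinearMap.add_apply, Module.End.mul_apply,
        Module.End.mul_apply, hAterm, hDterm, hA', hD',
        finsetOpProd_insert_of_lt B₂ (fun x hx => hm x (Finset.mem_sdiff.1 hx).1),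
        finsetOpProd_insert_of_lt B₁ (fun x hx => hm x (hJs hx)),
        Module.End.mul_apply, Module.End.mul_apply]
      simp only [Finset.prod_insert hmJ, Finset.prod_insert hmC, Finset.prod_mul_distrib,
        map_sub, map_smul, map_sum, hc]
      rw [swap (hPP J _), ← swap (hB₂P m J), swap (hPP J _)]
      module
    rw [Finset.sum_congr rfl key, Finset.sum_add_distrib, Finset.sum_sub_distrib,
      Finset.sum_powerset_sum_erase, sub_self, add_zero, Finset.sum_add_distrib]

section RTT

variable {Λ : Set ℂ} {adm : ℂ → ℂ → Prop} {f g : ℂ → ℂ → ℂ}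
  {T : ℂ → Matrix (Fin 2) (Fin 2) (EndH H)} {l m : ℂ}

theorem SatisfiesRTT.smul_comm_B (h : SatisfiesRTT Λ adm (fun l m => Rfg (f l m) (g l m)) T)
    (hl : l ∈ Λ) (hm : m ∈ Λ) (ha : adm l m) (x : H) :
    f l m • T l 0 1 (T m 0 1 x) = f l m • T m 0 1 (T l 0 1 x) := by
  have := LinearMap.congr_fun (congrFun (congrFun (h l m hl hm ha) (0, 0)) (1, 1)) x
  simpa [Matrix.mul_apply, Fintype.sum_prod_type, embedR, Rfg, aux1, aux2] using this

theorem SatisfiesRTT.A_B (h : SatisfiesRTT Λ adm (fun l m => Rfg (f l m) (g l m)) T)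
    (hl : l ∈ Λ) (hm : m ∈ Λ) (ha : adm m l) (x : H) :
    T l 0 0 (T m 0 1 x) = f m l • T m 0 1 (T l 0 0 x) - g m l • T l 0 1 (T m 0 0 x) := by
  have := LinearMap.congr_fun (congrFun (congrFun (h m l hm hl ha) (0, 0)) (1, 0)) x
  simp [Matrix.mul_apply, Fintype.sum_prod_type, embedR, Rfg, aux1, aux2] at this
  rw [this]
  abel

theorem SatisfiesRTT.D_B (h : SatisfiesRTT Λ adm (fun l m => Rfg (f l m) (g l m)) T)
    (hl : l ∈ Λ) (hm : m ∈ Λ) (ha : adm l m) (x : H) :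
    T l 1 1 (T m 0 1 x) = f l m • T m 0 1 (T l 1 1 x) - g l m • T l 0 1 (T m 1 1 x) := by
  have := LinearMap.congr_fun (congrFun (congrFun (h l m hl hm ha) (1, 0)) (1, 1)) x
  simp [Matrix.mul_apply, Fintype.sum_prod_type, embedR, Rfg, aux1, aux2] at this
  rw [← this]
  abel

end RTT

theorem gXXZ_antisymm (η l m : ℂ) : gXXZ η l m = -gXXZ η m l := by
  rw [gXXZ, gXXZ, ← neg_sub m l, Complex.sinh_neg, div_neg]

theorem fXXZ_mul_gXXZ_sub_left (η : ℂ) {x y z : ℂ} (hyx : Complex.sinh (y - x) ≠ 0)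
    (hzx : Complex.sinh (z - x) ≠ 0) (hyz : Complex.sinh (y - z) ≠ 0) :
    fXXZ η y x * gXXZ η z x - gXXZ η y x * gXXZ η z y = gXXZ η z x * fXXZ η y z := by
  rw [gXXZ_antisymm η z y]
  simp only [fXXZ, gXXZ]
  have hadd : Complex.sinh (y - x + η) * Complex.sinh (y - z) +
      Complex.sinh η * Complex.sinh (z - x) =
        Complex.sinh (y - z + η) * Complex.sinh (y - x) := by
    rw [show z - x = (y - x) - (y - z) by ring, Complex.sinh_add, Complex.sinh_add,
      Complex.sinh_sub (y - x)]
    ring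
  field_simp
  linear_combination Complex.sinh η * hadd

theorem fXXZ_mul_gXXZ_sub_right (η : ℂ) {x y z : ℂ} (hxy : Complex.sinh (x - y) ≠ 0)
    (hxz : Complex.sinh (x - z) ≠ 0) (hzy : Complex.sinh (z - y) ≠ 0) :
    fXXZ η x y * gXXZ η x z - gXXZ η x y * gXXZ η y z = gXXZ η x z * fXXZ η z y := by
  rw [gXXZ_antisymm η y z]
  simp only [fXXZ, gXXZ]
  have hadd : Complex.sinh (x - y + η) * Complex.sinh (z - y) +
      Complex.sinh η * Complex.sinh (x - z) =
        Complex.sinh (z - y + η) * Complex.sinh (x - y) := by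
    rw [show x - z = (x - y) - (z - y) by ring, Complex.sinh_add, Complex.sinh_add,
      Complex.sinh_sub (x - y)]
    ring
  field_simp
  linear_combination Complex.sinh η * hadd

/-- two-component model, XXZ case: the formal Bethe vector of the full
model expressed via the two components. -/
theorem two_component_Bethe_vectors_XXZ {H : Type} [AddCommGroup H] [Module ℂ H]
    (eta : ℂ) (Λ : Set ℂ)
    (T1 T2 : ℂ → Matrix (Fin 2) (Fin 2) (EndH H))
    (h1 : SatisfiesRTT Λ (fun lam mu => Complex.sinh (lam - mu) ≠ 0) (RXXZ eta) T1)
    (h2 : SatisfiesRTT Λ (fun lam mu => Complex.sinh (lam - mu) ≠ 0) (RXXZ eta) T2)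
    (hcomm : ∀ lam mu : ℂ, lam ∈ Λ → mu ∈ Λ →
      ∀ a b c d : Fin 2, Commute (T1 lam a b) (T2 mu c d))
    (v0 : H) (hv0 : v0 ≠ 0) (a1 d1 a2 d2 : ℂ → ℂ)
    (hA1 : ∀ lam : ℂ, lam ∈ Λ → T1 lam 0 0 v0 = a1 lam • v0)
    (hD1 : ∀ lam : ℂ, lam ∈ Λ → T1 lam 1 1 v0 = d1 lam • v0)
    (hC1 : ∀ lam : ℂ, lam ∈ Λ → T1 lam 1 0 v0 = 0)
    (hA2 : ∀ lam : ℂ, lam ∈ Λ → T2 lam 0 0 v0 = a2 lam • v0)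
    (hD2 : ∀ lam : ℂ, lam ∈ Λ → T2 lam 1 1 v0 = d2 lam • v0)
    (hC2 : ∀ lam : ℂ, lam ∈ Λ → T2 lam 1 0 v0 = 0)
    (M : ℕ) (lam : Fin M → ℂ) (hlam : ∀ i, lam i ∈ Λ)
    (hdist : ∀ j k : Fin M, j ≠ k → Complex.sinh (lam j - lam k) ≠ 0) :
    ((List.ofFn (fun i : Fin M =>
        T1 (lam i) 0 0 * T2 (lam i) 0 1 + T1 (lam i) 0 1 * T2 (lam i) 1 1)).prod) v0
      = ∑ J : Finset (Fin M),
          (((∏ j ∈ J, ∏ k ∈ Jᶜ, (fXXZ eta) (lam j) (lam k)) * (∏ j ∈ J, d2 (lam j)) *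
              (∏ k ∈ Jᶜ, a1 (lam k))) •
            ((finsetOpProd J (fun j => T1 (lam j) 0 1) *
                finsetOpProd Jᶜ (fun k => T2 (lam k) 0 1)) v0)) := by
  have h := finsetOpProd_two_component (f := fun i j => fXXZ eta (lam i) (lam j))
    (g := fun i j => gXXZ eta (lam i) (lam j))
    (fun i j hij => h1.A_B (hlam i) (hlam j) (hdist j i hij.symm))
    (fun i j hij => h2.D_B (hlam i) (hlam j) (hdist i j hij))
    (fun i j hij => h1.smul_comm_B (hlam i) (hlam j) (hdist i j hij))
    (fun i j hij => h2.smul_comm_B (hlam i) (hlam j) (hdist i j hij))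
    (fun i j k hij hik hjk => fXXZ_mul_gXXZ_sub_left eta (hdist j i hij.symm)
      (hdist k i hik.symm) (hdist j k hjk))
    (fun i j k hij hik hjk => fXXZ_mul_gXXZ_sub_right eta (hdist i j hij)
      (hdist i k hik) (hdist k j hjk.symm))
    (fun i j => gXXZ_antisymm eta _ _)
    (fun i j => hcomm _ _ (hlam i) (hlam j) 0 0 0 1)
    (fun i j => hcomm _ _ (hlam i) (hlam j) 0 1 0 1)
    (fun i j => (hcomm _ _ (hlam j) (hlam i) 0 1 1 1).symm)
    (fun i => hA1 _ (hlam i)) (fun i => hD2 _ (hlam i)) Finset.univ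
  rw [finsetOpProd_univ_fin, Finset.powerset_univ] at h
  simpa only [← Finset.compl_eq_univ_sdiff, ← Module.End.mul_apply] using h

end
end

section
/- (Local structure of formal Bethe vectors, XXX case.) Let H be a complex vector space, N ≥ 1, and let ξ₁, …, ξ_N ∈ ℂ. For j = 1, …, N let Lⱼ(λ) = [[Aⱼ(λ),Bⱼ(λ)],[Cⱼ(λ),Dⱼ(λ)]] be monodromy matrices on H with common domain Λ ⊆ ℂ, each satisfying the RTT relation with the rational (XXX-type) R-matrix, such that every matrix entry of Lᵢ(λ) commutes with every matrix entry of Lⱼ(μ) whenever i ≠ j. Suppose there is a nonzero vector |0⟩ ∈ H and scalar functions α, δ of two complex variables such that for all j and all λ ∈ Λ: Aⱼ(λ)|0⟩ = α(λ,ξⱼ)|0⟩, Dⱼ(λ)|0⟩ = δ(λ,ξⱼ)|0⟩, Cⱼ(λ)|0⟩ = 0, and moreover Bⱼ(λ)Bⱼ(μ)|0⟩ = 0 for all λ, μ ∈ Λ. Let B(λ) be the (1,2) entry of T(λ) = L₁(λ)L₂(λ)⋯L_N(λ). Then for any pairwise distinct λ₁, …, λ_M ∈ Λ: B(λ₁)⋯B(λ_M)|0⟩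 = Σ_{1≤n₁<n₂<⋯<n_M≤N} Σ_{σ ∈ S_M} B_{n₁}(λ_{σ(1)}) B_{n₂}(λ_{σ(2)}) ⋯ B_{n_M}(λ_{σ(M)}) |0⟩ × ∏_{l=1}^M [ ( ∏_{i=1}^{n_l−1} α(λ_{σ(l)},ξᵢ) ) ( ∏_{j=n_l+1}^{N} δ(λ_{σ(l)},ξⱼ) ) ( ∏_{r=l+1}^{M} f(λ_{σ(l)},λ_{σ(r)}) ) ], where f(λ,μ) = (λ−μ+1)/(λ−μ) and S_M is the symmetric group on {1,…,M}. -/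
open scoped BigOperators

noncomputable section

variable {H : Type} [AddCommGroup H] [Module ℂ H]

section MonodromyProducts

theorem aux1_mul (S T : Matrix (Fin 2) (Fin 2) (EndH H)) : aux1 (S * T) = aux1 S * aux1 T := by
  ext1 ⟨a, b⟩ ⟨c, d⟩
  fin_cases b <;> fin_cases d <;>
    simp [aux1, Matrix.mul_apply, Fintype.sum_prod_type]

theorem aux2_mul (S T : Matrix (Fin 2) (Fin 2) (EndH H)) : aux2 (S * T) = aux2 S * aux2 T := by
  ext1 ⟨a, b⟩ ⟨c, d⟩
  fin_cases a <;> fin_cases c <;>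
    simp [aux2, Matrix.mul_apply, Fintype.sum_prod_type]

theorem aux1_mul_aux2_apply (S T : Matrix (Fin 2) (Fin 2) (EndH H)) (a b c d : Fin 2) :
    (aux1 S * aux2 T) (a, b) (c, d) = S a c * T b d := by
  simp [aux1, aux2, Matrix.mul_apply, Fintype.sum_prod_type]

theorem aux2_mul_aux1_apply (S T : Matrix (Fin 2) (Fin 2) (EndH H)) (a b c d : Fin 2) :
    (aux2 T * aux1 S) (a, b) (c, d) = T b d * S a c := by
  simp [aux1, aux2, Matrix.mul_apply, Fintype.sum_prod_type]

theorem commute_aux1_aux2 {S T : Matrix (Fin 2) (Fin 2) (EndH H)}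
    (h : ∀ a b c d, Commute (S a b) (T c d)) : Commute (aux1 S) (aux2 T) := by
  ext1 ⟨a, b⟩ ⟨c, d⟩
  rw [aux1_mul_aux2_apply, aux2_mul_aux1_apply, (h a c b d).eq]

theorem aux1_one : aux1 (1 : Matrix (Fin 2) (Fin 2) (EndH H)) = 1 := by
  ext1 ⟨a, b⟩ ⟨c, d⟩
  fin_cases b <;> fin_cases d <;> simp [aux1, Matrix.one_apply]

theorem aux2_one : aux2 (1 : Matrix (Fin 2) (Fin 2) (EndH H)) = 1 := by
  ext1 ⟨a, b⟩ ⟨c, d⟩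
  fin_cases a <;> fin_cases c <;> simp [aux2, Matrix.one_apply]

variable {Λ : Set ℂ} {adm : ℂ → ℂ → Prop}
  {R : ℂ → ℂ → Matrix (Fin 2 × Fin 2) (Fin 2 × Fin 2) ℂ}

theorem SatisfiesRTT.one : SatisfiesRTT (H := H) Λ adm R (fun _ => 1) := by
  intro l m _ _ _
  simp [aux1_one, aux2_one]

/-- The product of two commuting monodromy matrices is a monodromy matrix. -/
theorem SatisfiesRTT.mul {S T : ℂ → Matrix (Fin 2) (Fin 2) (EndH H)}
    (hS : SatisfiesRTT Λ adm R S) (hT : SatisfiesRTT Λ adm R T)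
    (hST : ∀ l ∈ Λ, ∀ m ∈ Λ, ∀ a b c d, Commute (S l a b) (T m c d)) :
    SatisfiesRTT Λ adm R (fun l => S l * T l) := by
  intro l m hl hm hlm
  have h₁ : aux1 (T l) * aux2 (S m) = aux2 (S m) * aux1 (T l) :=
    commute_aux1_aux2 fun a b c d => (hST m hm l hl c d a b).symm
  have h₂ : aux1 (S l) * aux2 (T m) = aux2 (T m) * aux1 (S l) :=
    commute_aux1_aux2 (hST l hl m hm)
  have hS' := hS l m hl hm hlm
  have hT' := hT l m hl hm hlm
  simp only [aux1_mul, aux2_mul]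
  calc embedR (R l m) * (aux1 (S l) * aux1 (T l)) * (aux2 (S m) * aux2 (T m))
      = embedR (R l m) * aux1 (S l) * (aux1 (T l) * aux2 (S m)) * aux2 (T m) := by
        simp only [mul_assoc]
    _ = (embedR (R l m) * aux1 (S l) * aux2 (S m)) * (aux1 (T l) * aux2 (T m)) := by
        rw [h₁]; simp only [mul_assoc]
    _ = aux2 (S m) * aux1 (S l) * (embedR (R l m) * aux1 (T l) * aux2 (T m)) := by
        rw [hS']; simp only [mul_assoc]
    _ = aux2 (S m) * (aux1 (S l) * aux2 (T m)) * aux1 (T l) * embedR (R l m) := by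
        rw [hT']; simp only [mul_assoc]
    _ = _ := by rw [h₂]; simp only [mul_assoc]

theorem commute_entries_mul {X : EndH H} {S T : Matrix (Fin 2) (Fin 2) (EndH H)}
    (hS : ∀ a b, Commute X (S a b)) (hT : ∀ a b, Commute X (T a b)) (a b : Fin 2) :
    Commute X ((S * T) a b) := by
  rw [Matrix.mul_apply]
  exact Commute.sum_right _ _ _ fun c _ => (hS a c).mul_right (hT c b)

theorem commute_entries_prod_ofFn {N : ℕ} {X : EndH H}
    {L : Fin N → Matrix (Fin 2) (Fin 2) (EndH H)}
    (h : ∀ j a b, Commute X (L j a b)) (a b : Fin 2) :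
    Commute X ((List.ofFn L).prod a b) := by
  induction N generalizing a b with
  | zero =>
    rw [List.ofFn_zero, List.prod_nil, Matrix.one_apply]
    split_ifs
    · exact Commute.one_right X
    · exact Commute.zero_right X
  | succ N ih =>
    rw [List.ofFn_succ, List.prod_cons]
    exact commute_entries_mul (h 0) (ih fun j => h j.succ) a b

theorem SatisfiesRTT.prod_ofFn {N : ℕ} {L : Fin N → ℂ → Matrix (Fin 2) (Fin 2) (EndH H)}
    (hL : ∀ j, SatisfiesRTT Λ adm R (L j))
    (hcomm : ∀ i j : Fin N, i ≠ j → ∀ l m : ℂ, l ∈ Λ → m ∈ Λ →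
      ∀ a b c d : Fin 2, Commute (L i l a b) (L j m c d)) :
    SatisfiesRTT Λ adm R (fun l => (List.ofFn fun j => L j l).prod) := by
  induction N with
  | zero => simpa using SatisfiesRTT.one
  | succ N ih =>
    simp only [List.ofFn_succ, List.prod_cons]
    refine (hL 0).mul (ih (fun j => hL j.succ) fun i j hij =>
      hcomm _ _ (Fin.succ_injective _ |>.ne hij)) fun l hl m hm a b c d => ?_
    exact commute_entries_prod_ofFn
      (fun j c d => hcomm 0 j.succ (Fin.succ_ne_zero j).symm l m hl hm a b c d) c d

/-- The reference vector is annihilated by the lower left entry of a product of monodromy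
matrices, and is an eigenvector of the lower right one. -/
theorem prod_ofFn_lower_apply {N : ℕ} {L : Fin N → Matrix (Fin 2) (Fin 2) (EndH H)} {v : H}
    {δ : Fin N → ℂ} (hcomm : ∀ i j : Fin N, i ≠ j → ∀ a b c d, Commute (L i a b) (L j c d))
    (hC : ∀ j, L j 1 0 v = 0) (hD : ∀ j, L j 1 1 v = δ j • v) :
    (List.ofFn L).prod 1 0 v = 0 ∧ (List.ofFn L).prod 1 1 v = (∏ j, δ j) • v := by
  induction N with
  | zero => simp
  | succ N ih =>
    obtain ⟨h₀, h₁⟩ := ih (fun i j hij => hcomm _ _ ((Fin.succ_injective _).ne hij))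
      (fun j => hC j.succ) (fun j => hD j.succ)
    have hX (c d : Fin 2) : L 0 1 0 ((List.ofFn fun j : Fin N => L j.succ).prod c d v) = 0 := by
      have h := commute_entries_prod_ofFn
        (fun j c d => hcomm 0 (Fin.succ j) (Fin.succ_ne_zero j).symm 1 0 c d) c d
      rw [← Module.End.mul_apply, h.eq, Module.End.mul_apply, hC, map_zero]
    rw [List.ofFn_succ, List.prod_cons]
    simp [Matrix.mul_apply, hX, h₀, h₁, hD, Fin.prod_univ_succ, smul_smul, mul_comm]

end MonodromyProducts

section ExchangeRelations

variable {Λ : Set ℂ} {T : ℂ → Matrix (Fin 2) (Fin 2) (EndH H)} {l m : ℂ}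

theorem fXXX_eq_one_add_gXXX (h : l ≠ m) : fXXX l m = 1 + gXXX l m := by
  have := sub_ne_zero.2 h
  rw [fXXX, gXXX]
  field_simp

theorem gXXX_antisymm (l m : ℂ) : gXXX m l = -gXXX l m := by
  rw [gXXX, gXXX, ← neg_sub l m, div_neg]

/-- The exchange relation of the lower right and the upper right entries. -/
theorem SatisfiesRTT.apply_D_B (hT : SatisfiesRTT Λ (fun l m => l ≠ m) RXXX T)
    (hl : l ∈ Λ) (hm : m ∈ Λ) (hlm : l ≠ m) (w : H) :
    T l 1 1 (T m 0 1 w) = fXXX l m • T m 0 1 (T l 1 1 w) - gXXX l m • T l 0 1 (T m 1 1 w) := by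
  have h := congrFun₂ (hT l m hl hm hlm) (1, 0) (1, 1)
  rw [mul_assoc, Matrix.mul_apply, Matrix.mul_apply] at h
  simp only [Fintype.sum_prod_type, Fin.sum_univ_two, aux1_mul_aux2_apply,
    aux2_mul_aux1_apply] at h
  simp [embedR, RXXX, Rfg] at h
  have h' := LinearMap.congr_fun h w
  simp at h'
  rw [← h']
  abel

/-- The exchange relation of the upper left and the upper right entries. -/
theorem SatisfiesRTT.apply_A_B (hT : SatisfiesRTT Λ (fun l m => l ≠ m) RXXX T)
    (hl : l ∈ Λ) (hm : m ∈ Λ) (hlm : l ≠ m) (w : H) :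
    T l 0 0 (T m 0 1 w) = fXXX m l • T m 0 1 (T l 0 0 w) - gXXX m l • T l 0 1 (T m 0 0 w) := by
  have h := congrFun₂ (hT m l hm hl hlm.symm) (0, 0) (1, 0)
  rw [mul_assoc, Matrix.mul_apply, Matrix.mul_apply] at h
  simp only [Fintype.sum_prod_type, Fin.sum_univ_two, aux1_mul_aux2_apply,
    aux2_mul_aux1_apply] at h
  simp [embedR, RXXX, Rfg] at h
  have h' := LinearMap.congr_fun h w
  simp at h'
  rw [h']
  abel

theorem SatisfiesRTT.commute_B (hT : SatisfiesRTT Λ (fun l m => l ≠ m) RXXX T)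
    (hl : l ∈ Λ) (hm : m ∈ Λ) : Commute (T l 0 1) (T m 0 1) := by
  have key {l m : ℂ} (hl : l ∈ Λ) (hm : m ∈ Λ) (hlm : l ≠ m) (hf : l - m + 1 ≠ 0) :
      Commute (T l 0 1) (T m 0 1) := by
    have h := congrFun₂ (hT l m hl hm hlm) (0, 0) (1, 1)
    rw [mul_assoc, Matrix.mul_apply, Matrix.mul_apply] at h
    simp only [Fintype.sum_prod_type, Fin.sum_univ_two, aux1_mul_aux2_apply,
      aux2_mul_aux1_apply] at h
    simp [embedR, RXXX, Rfg] at h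
    exact smul_right_injective _ (div_ne_zero hf (sub_ne_zero.2 hlm)) h
  obtain rfl | hlm := eq_or_ne l m
  · exact Commute.refl _
  by_cases hf : l - m + 1 = 0
  · refine (key hm hl hlm.symm ?_).symm
    rw [show m - l + 1 = 2 by linear_combination -hf]
    norm_num
  · exact key hl hm hlm hf

end ExchangeRelations

section BetheVectors

variable {ι : Type}

/-- The vector obtained by applying the commuting operators `B i`, `i ∈ s`, to `v`. -/
def betheVec (B : ι → EndH H) (hB : ∀ i j, Commute (B i) (B j)) (v : H) (s : Finset ι) : H :=
  s.noncommProd B (Set.pairwise_of_forall _ _ hB) v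

variable {B D : ι → EndH H} {hB : ∀ i j, Commute (B i) (B j)} {v : H}

@[simp]
theorem betheVec_empty : betheVec B hB v ∅ = v := by
  rw [betheVec, Finset.noncommProd_empty, Module.End.one_apply]

theorem apply_betheVec_comm {X : EndH H} (hX : ∀ i, Commute X (B i)) (s : Finset ι) :
    X (betheVec B hB v s) = betheVec B hB (X v) s := by
  have h := Finset.noncommProd_commute s B (Set.pairwise_of_forall _ _ hB) X fun i _ => hX i
  exact LinearMap.congr_fun h.eq v

theorem betheVec_map_univ {m : ℕ} (e : Fin m ↪ ι) :
    betheVec B hB v (Finset.univ.map e) = (List.ofFn fun k => B (e k)).prod v := by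
  have h : (Finset.univ.map e).val.map B = (List.ofFn fun k => B (e k) : Multiset (EndH H)) := by
    rw [Finset.map_val, Multiset.map_map, Fin.univ_val_map]
    rfl
  simp only [betheVec, Finset.noncommProd, h, Multiset.noncommProd_coe]

variable [DecidableEq ι]

theorem betheVec_insert {i : ι} {s : Finset ι} (hi : i ∉ s) :
    betheVec B hB v (insert i s) = B i (betheVec B hB v s) := by
  rw [betheVec, Finset.noncommProd_insert_of_notMem _ _ _ _ hi, Module.End.mul_apply, betheVec]

theorem prod_insert_erase {i k : ι} {s : Finset ι} (hi : i ∉ s) (hk : k ∈ s) (F : ι → ℂ) :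
    ∏ j ∈ (insert i s).erase k, F j = F i * ∏ j ∈ s.erase k, F j := by
  rw [Finset.erase_insert_of_ne (ne_of_mem_of_not_mem hk hi).symm,
    Finset.prod_insert fun h => hi (Finset.mem_of_mem_erase h)]

theorem betheVec_insert_erase {i k : ι} {s : Finset ι} (hi : i ∉ s) (hk : k ∈ s) :
    betheVec B hB v ((insert i s).erase k) = B i (betheVec B hB v (s.erase k)) := by
  rw [Finset.erase_insert_of_ne (ne_of_mem_of_not_mem hk hi).symm,
    betheVec_insert fun h => hi (Finset.mem_of_mem_erase h)]

variable {x : ι → ℂ}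

/-- The action of the lower right entry on a Bethe vector. -/
theorem apply_D_betheVec (hx : Function.Injective x) {d : ι → ℂ}
    (hDB : ∀ i j, i ≠ j → ∀ w, D i (B j w) =
      fXXX (x i) (x j) • B j (D i w) - gXXX (x i) (x j) • B i (D j w))
    (hD : ∀ i, D i v = d i • v) (s : Finset ι) (i : ι) (hi : i ∉ s) :
    D i (betheVec B hB v s) =
      (d i * ∏ k ∈ s, fXXX (x i) (x k)) • betheVec B hB v s
        - ∑ k ∈ s, (d k * gXXX (x i) (x k) * ∏ j ∈ s.erase k, fXXX (x k) (x j)) •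
          B i (betheVec B hB v (s.erase k)) := by
  induction s using Finset.induction_on generalizing i with
  | empty => simp [hD]
  | insert m s hm ih =>
    rw [Finset.mem_insert, not_or] at hi
    have hBc (i j : ι) (w : H) : B i (B j w) = B j (B i w) := LinearMap.congr_fun (hB i j).eq w
    rw [betheVec_insert hm, hDB i m hi.1, ih i hi.2, ih m hm, Finset.sum_insert hm,
      Finset.erase_insert hm, Finset.prod_insert hm]
    have hsum : ∑ k ∈ s, (d k * gXXX (x i) (x k) *
          ∏ j ∈ (insert m s).erase k, fXXX (x k) (x j)) •
          B i (betheVec B hB v ((insert m s).erase k)) =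
        fXXX (x i) (x m) • ∑ k ∈ s, (d k * gXXX (x i) (x k) *
          ∏ j ∈ s.erase k, fXXX (x k) (x j)) • B m (B i (betheVec B hB v (s.erase k))) -
        gXXX (x i) (x m) • ∑ k ∈ s, (d k * gXXX (x m) (x k) *
          ∏ j ∈ s.erase k, fXXX (x k) (x j)) • B i (B m (betheVec B hB v (s.erase k))) := by
      rw [Finset.smul_sum, Finset.smul_sum, ← Finset.sum_sub_distrib]
      refine Finset.sum_congr rfl fun k hk => ?_
      rw [prod_insert_erase hm hk, betheVec_insert_erase hm hk, hBc m i, smul_smul, smul_smul,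
        ← sub_smul]
      congr 1
      have hkm : k ≠ m := fun h => hm (h ▸ hk)
      have h₁ : x i - x m ≠ 0 := sub_ne_zero.2 (hx.ne hi.1)
      have h₂ : x i - x k ≠ 0 := sub_ne_zero.2 (hx.ne fun h => hi.2 (h ▸ hk))
      have h₃ : x k - x m ≠ 0 := sub_ne_zero.2 (hx.ne hkm)
      have h₄ : x m - x k ≠ 0 := sub_ne_zero.2 (hx.ne hkm.symm)
      have key : gXXX (x i) (x k) * fXXX (x k) (x m) =
          fXXX (x i) (x m) * gXXX (x i) (x k) - gXXX (x i) (x m) * gXXX (x m) (x k) := by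
        rw [gXXX, gXXX, gXXX, fXXX, fXXX]
        field_simp
        ring
      linear_combination (d k * ∏ j ∈ s.erase k, fXXX (x k) (x j)) * key
    rw [hsum]
    simp only [map_sub, map_smul, map_sum, smul_sub, smul_smul]
    module

/-- The two-site composition formula in the case where the first factor creates at most
one excitation. -/
theorem betheVec_comp {A₀ B₀ Bt : ι → EndH H} {hBt : ∀ i j, Commute (Bt i) (Bt j)}
    (hx : Function.Injective x) {a d : ι → ℂ}
    (hsum : ∀ i w, Bt i w = A₀ i (B i w) + B₀ i (D i w))
    (hDB : ∀ i j, i ≠ j → ∀ w, D i (B j w) =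
      fXXX (x i) (x j) • B j (D i w) - gXXX (x i) (x j) • B i (D j w))
    (hAB : ∀ i j, i ≠ j → ∀ w, A₀ i (B₀ j w) =
      fXXX (x j) (x i) • B₀ j (A₀ i w) - gXXX (x j) (x i) • B₀ i (A₀ j w))
    (hA₀B : ∀ i j, Commute (A₀ i) (B j)) (hB₀B : ∀ i j, Commute (B₀ i) (B j))
    (hB₀D : ∀ i j, Commute (B₀ i) (D j))
    (hA : ∀ i, A₀ i v = a i • v) (hD : ∀ i, D i v = d i • v)
    (hBB : ∀ i j, B₀ i (B₀ j v) = 0) (s : Finset ι) :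
    betheVec Bt hBt v s =
      (∏ j ∈ s, a j) • betheVec B hB v s +
        ∑ i ∈ s, (d i * ∏ j ∈ s.erase i, (a j * fXXX (x i) (x j))) •
          B₀ i (betheVec B hB v (s.erase i)) := by
  induction s using Finset.induction_on with
  | empty => simp
  | insert m s hm ih =>
    have hAv (i : ι) (t : Finset ι) : A₀ i (betheVec B hB v t) = a i • betheVec B hB v t := by
      rw [apply_betheVec_comm (hA₀B i), hA, betheVec, map_smul, betheVec]
    have hBBv (i j : ι) (t : Finset ι) : B₀ i (B₀ j (betheVec B hB v t)) = 0 := by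
      rw [apply_betheVec_comm (hB₀B j), apply_betheVec_comm (hB₀B i), hBB, betheVec, map_zero]
    have hA₀Bw (i j : ι) (w : H) : A₀ i (B j w) = B j (A₀ i w) :=
      LinearMap.congr_fun (hA₀B i j).eq w
    have hB₀Bw (i j : ι) (w : H) : B₀ i (B j w) = B j (B₀ i w) :=
      LinearMap.congr_fun (hB₀B i j).eq w
    have hB₀Dw (i j : ι) (w : H) : D j (B₀ i w) = B₀ i (D j w) :=
      (LinearMap.congr_fun (hB₀D i j).eq w).symm
    have hD₂ (k : ι) : B₀ m (D m (B₀ k (betheVec B hB v (s.erase k)))) = 0 := by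
      rw [hB₀Dw, apply_D_betheVec hx hDB hD (s.erase k) m
        (fun h => hm (Finset.mem_of_mem_erase h))]
      simp only [map_sub, map_smul, map_sum, hBBv, hB₀Bw, smul_zero, map_zero,
        Finset.sum_const_zero, sub_zero]
    have hterm : ∑ k ∈ s, (d k * ∏ j ∈ (insert m s).erase k, (a j * fXXX (x k) (x j))) •
          B₀ k (betheVec B hB v ((insert m s).erase k)) =
        ∑ k ∈ s, (d k * ∏ j ∈ s.erase k, (a j * fXXX (x k) (x j))) •
          A₀ m (B m (B₀ k (betheVec B hB v (s.erase k)))) -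
        (∏ j ∈ s, a j) • ∑ k ∈ s, (d k * gXXX (x m) (x k) *
          ∏ j ∈ s.erase k, fXXX (x k) (x j)) • B₀ m (B m (betheVec B hB v (s.erase k))) := by
      rw [Finset.smul_sum, ← Finset.sum_sub_distrib]
      refine Finset.sum_congr rfl fun k hk => ?_
      have hkm : m ≠ k := fun h => hm (h ▸ hk)
      rw [prod_insert_erase hm hk, betheVec_insert_erase hm hk, hA₀Bw, hAB m k hkm, hAv, hAv,
        gXXX_antisymm (x m) (x k), ← Finset.mul_prod_erase s a hk, Finset.prod_mul_distrib]
      simp only [map_sub, map_smul, hB₀Bw]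
      module
    rw [betheVec_insert hm, hsum, ih, Finset.sum_insert hm, Finset.erase_insert hm,
      betheVec_insert hm, Finset.prod_insert hm, hterm]
    simp only [map_add, map_sum, map_smul, hD₂, smul_zero, Finset.sum_const_zero, add_zero,
      apply_D_betheVec hx hDB hD s m hm, hA₀Bw, hAv, map_sub, Finset.prod_mul_distrib]
    module

end BetheVectors

section Configurations

theorem sum_perm_fin_succ {m : ℕ} {E : Type} [AddCommMonoid E]
    (F : (Fin (m + 1) → Fin (m + 1)) → E) :
    ∑ σ : Equiv.Perm (Fin (m + 1)), F σ =
      ∑ i, ∑ σ : Equiv.Perm (Fin m), F (Fin.cons i fun k => i.succAbove (σ k)) := by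
  let e (p : Fin (m + 1) × Equiv.Perm (Fin m)) : Equiv.Perm (Fin (m + 1)) :=
    p.1.cycleRange.symm * Equiv.Perm.decomposeFin.symm (0, p.2)
  have he₀ (p) : e p 0 = p.1 := by simp [e]
  have he (p) : ⇑(e p) = Fin.cons p.1 fun k => p.1.succAbove (p.2 k) := by
    ext1 k
    refine Fin.cases ?_ (fun k => ?_) k <;> simp [e]
  have hinj : Function.Injective e := by
    rintro ⟨i, σ⟩ ⟨j, τ⟩ h
    obtain rfl : i = j := by simpa [he₀] using congrArg (fun s => s 0) h
    simpa [e] using h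
  have hbij : Function.Bijective e := by
    rw [Fintype.bijective_iff_injective_and_card]
    exact ⟨hinj, by simp [Fintype.card_perm, Nat.factorial_succ]⟩
  rw [← Fintype.sum_prod_type', ← hbij.sum_comp fun σ => F σ]
  simp only [he]

theorem sum_strictMono_fin_succ {m N : ℕ} {E : Type} [AddCommMonoid E]
    (F : (Fin (m + 1) → Fin (N + 1)) → E) :
    ∑ n : Fin (m + 1) → Fin (N + 1) with ∀ k l, k < l → n k < n l, F n =
      ∑ n : Fin (m + 1) → Fin N with ∀ k l, k < l → n k < n l, F (fun k => (n k).succ) +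
        ∑ n : Fin m → Fin N with ∀ k l, k < l → n k < n l,
          F (Fin.cons 0 fun k => (n k).succ) := by
  rw [← Finset.sum_filter_not_add_sum_filter _ fun n => n 0 = 0, Finset.filter_filter,
    Finset.filter_filter]
  have hpos {n : Fin (m + 1) → Fin (N + 1)} (hn : ∀ k l, k < l → n k < n l) (h0 : n 0 ≠ 0)
      (k) : n k ≠ 0 := by
    obtain rfl | hk := eq_or_ne k 0
    · exact h0
    · exact Fin.ne_zero_of_lt (hn 0 k (Fin.pos_iff_ne_zero.2 hk))
  have hpos' {n : Fin (m + 1) → Fin (N + 1)} (hn : ∀ k l, k < l → n k < n l) (k : Fin m) :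
      n k.succ ≠ 0 := Fin.ne_zero_of_lt (hn 0 k.succ k.succ_pos)
  congr 1
  · symm
    refine Finset.sum_bij (fun n _ k => (n k).succ) ?_ ?_ ?_ fun _ _ => rfl
    · intro n hn
      simpa using hn
    · intro n _ n' _ h
      ext1 k
      exact Fin.succ_injective _ (congrFun h k)
    · intro n hn
      simp only [Finset.mem_filter, Finset.mem_univ, true_and] at hn
      refine ⟨fun k => (n k).pred (hpos hn.1 hn.2 k), ?_, by simp⟩
      simpa using hn.1
  · symm
    refine Finset.sum_bij (fun n _ => Fin.cons 0 fun k => (n k).succ) ?_ ?_ ?_ fun _ _ => rfl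
    · intro n hn
      simpa [Fin.forall_fin_succ] using hn
    · intro n _ n' _ h
      ext1 k
      exact Fin.succ_injective _ (by simpa using congrFun h k.succ)
    · intro n hn
      simp only [Finset.mem_filter, Finset.mem_univ, true_and] at hn
      refine ⟨fun k => (n k.succ).pred (hpos' hn.1 k), ?_, ?_⟩
      · simpa using fun (k l : Fin m) hkl => hn.1 k.succ l.succ (Fin.succ_lt_succ_iff.2 hkl)
      · ext1 k
        refine Fin.cases ?_ (fun k => ?_) k <;> simp [hn.2]

/-- The coefficient of the configuration in which the excitation with parameter `y l` sits at
the site `n l`. -/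
def localCoeff {N M : ℕ} (xi : Fin N → ℂ) (alpha delta : ℂ → ℂ → ℂ)
    (n : Fin M → Fin N) (y : Fin M → ℂ) : ℂ :=
  ∏ l : Fin M,
    ((∏ i ∈ Finset.univ.filter (fun i : Fin N => i < n l), alpha (y l) (xi i)) *
      (∏ j ∈ Finset.univ.filter (fun j : Fin N => n l < j), delta (y l) (xi j)) *
      (∏ r ∈ Finset.univ.filter (fun r : Fin M => l < r), fXXX (y l) (y r)))

variable {N : ℕ} (xi : Fin (N + 1) → ℂ) (alpha delta : ℂ → ℂ → ℂ)

theorem localCoeff_succ {M : ℕ} (n : Fin M → Fin N) (y : Fin M → ℂ) :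
    localCoeff xi alpha delta (fun k => (n k).succ) y =
      (∏ l, alpha (y l) (xi 0)) * localCoeff (fun j => xi j.succ) alpha delta n y := by
  simp only [localCoeff, ← Finset.prod_mul_distrib, Finset.prod_filter]
  refine Finset.prod_congr rfl fun l _ => ?_
  simp [Fin.prod_univ_succ, mul_assoc]

theorem localCoeff_cons {m : ℕ} (n : Fin m → Fin N) (z : ℂ) (y : Fin m → ℂ) :
    localCoeff xi alpha delta (Fin.cons 0 fun k => (n k).succ : Fin (m + 1) → Fin (N + 1))
        (Fin.cons z y) =
      ((∏ j : Fin N, delta z (xi j.succ)) * ∏ r, (alpha (y r) (xi 0) * fXXX z (y r))) *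
        localCoeff (fun j => xi j.succ) alpha delta n y := by
  rw [Finset.prod_mul_distrib, mul_comm (∏ r, alpha (y r) (xi 0)), ← mul_assoc, mul_assoc,
    ← localCoeff_succ, localCoeff, Fin.prod_univ_succ]
  congr 1
  · simp [Finset.prod_filter, Fin.prod_univ_succ]
  · simp [localCoeff, Finset.prod_filter, Fin.prod_univ_succ (n := m)]

end Configurations

/-- The expansion of a Bethe vector of a possibly empty product of monodromy matrices. -/
theorem prod_upperRight_apply_eq_sum {Λ : Set ℂ} {v : H} {alpha delta : ℂ → ℂ → ℂ}
    {N : ℕ} {xi : Fin N → ℂ} {L : Fin N → ℂ → Matrix (Fin 2) (Fin 2) (EndH H)}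
    (hRTT : ∀ j : Fin N, SatisfiesRTT Λ (fun lam mu => lam ≠ mu) RXXX (L j))
    (hcomm : ∀ i j : Fin N, i ≠ j → ∀ lam mu : ℂ, lam ∈ Λ → mu ∈ Λ →
      ∀ a b c d : Fin 2, Commute (L i lam a b) (L j mu c d))
    (hA : ∀ (j : Fin N) (lam : ℂ), lam ∈ Λ → L j lam 0 0 v = alpha lam (xi j) • v)
    (hD : ∀ (j : Fin N) (lam : ℂ), lam ∈ Λ → L j lam 1 1 v = delta lam (xi j) • v)
    (hC : ∀ (j : Fin N) (lam : ℂ), lam ∈ Λ → L j lam 1 0 v = 0)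
    (hBB : ∀ (j : Fin N) (lam mu : ℂ), lam ∈ Λ → mu ∈ Λ → L j lam 0 1 (L j mu 0 1 v) = 0)
    {M : ℕ} {x : Fin M → ℂ} (hxΛ : ∀ i, x i ∈ Λ) (hx : Function.Injective x) :
    (List.ofFn fun i => (List.ofFn fun j => L j (x i)).prod 0 1).prod v =
      ∑ n : Fin M → Fin N with ∀ k l, k < l → n k < n l, ∑ σ : Equiv.Perm (Fin M),
        localCoeff xi alpha delta n (fun k => x (σ k)) •
          (List.ofFn fun k => L (n k) (x (σ k)) 0 1).prod v := by
  induction N generalizing M with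
  | zero =>
    cases M with
    | zero => simp [localCoeff]
    | succ m => simp
  | succ N ih =>
    cases M with
    | zero => simp [localCoeff]
    | succ m =>
      have hcomm' : ∀ i j : Fin N, i ≠ j → ∀ lam mu : ℂ, lam ∈ Λ → mu ∈ Λ →
          ∀ a b c d : Fin 2, Commute (L i.succ lam a b) (L j.succ mu c d) :=
        fun i j hij => hcomm _ _ ((Fin.succ_injective _).ne hij)
      have ih' {M : ℕ} {y : Fin M → ℂ} (hyΛ : ∀ i, y i ∈ Λ) (hy : Function.Injective y) :=
        ih (xi := fun j => xi j.succ) (fun j => hRTT j.succ) hcomm' (fun j => hA j.succ)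
          (fun j => hD j.succ) (fun j => hC j.succ) (fun j => hBB j.succ) hyΛ hy
      have hT := SatisfiesRTT.prod_ofFn hRTT hcomm
      have hT' := SatisfiesRTT.prod_ofFn (fun j : Fin N => hRTT j.succ) hcomm'
      have hL₀ (i j : Fin (m + 1)) (a b c d : Fin 2) :
          Commute (L 0 (x i) a b) ((List.ofFn fun k : Fin N => L k.succ (x j)).prod c d) :=
        commute_entries_prod_ofFn (fun k c d =>
          hcomm 0 k.succ (Fin.succ_ne_zero k).symm _ _ (hxΛ i) (hxΛ j) a b c d) c d
      have hBt (i j : Fin (m + 1)) := hT.commute_B (hxΛ i) (hxΛ j)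
      have hB (i j : Fin (m + 1)) := hT'.commute_B (hxΛ i) (hxΛ j)
      have hmap := betheVec_map_univ (hB := hBt) (v := v) (Function.Embedding.refl _)
      rw [Finset.map_refl] at hmap
      have hmap' := betheVec_map_univ (hB := hB) (v := v) (Function.Embedding.refl _)
      rw [Finset.map_refl] at hmap'
      have herase (i : Fin (m + 1)) : Finset.univ.erase i =
          Finset.univ.map i.succAboveEmb := by
        ext j
        simp [Fin.exists_succAbove_eq_iff]
      refine hmap.symm.trans ?_
      rw [betheVec_comp (hB := hB) hx
        (D := fun i => (List.ofFn fun k : Fin N => L k.succ (x i)).prod 1 1)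
        (A₀ := fun i => L 0 (x i) 0 0) (B₀ := fun i => L 0 (x i) 0 1)
        (a := fun i => alpha (x i) (xi 0)) (d := fun i => ∏ j : Fin N, delta (x i) (xi j.succ))
        (fun i w => by simp [List.ofFn_succ, Matrix.mul_apply])
        (fun i j hij => hT'.apply_D_B (hxΛ i) (hxΛ j) (hx.ne hij))
        (fun i j hij => (hRTT 0).apply_A_B (hxΛ i) (hxΛ j) (hx.ne hij))
        (fun i j => hL₀ i j _ _ _ _) (fun i j => hL₀ i j _ _ _ _) (fun i j => hL₀ i j _ _ _ _)
        (fun i => hA 0 _ (hxΛ i))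
        (fun i => (prod_ofFn_lower_apply (fun k l hkl => hcomm' k l hkl _ _ (hxΛ i) (hxΛ i))
          (fun j => hC j.succ _ (hxΛ i)) (fun j => hD j.succ _ (hxΛ i))).2)
        (fun i j => hBB 0 _ _ (hxΛ i) (hxΛ j))]
      rw [sum_strictMono_fin_succ]
      congr 1
      · rw [hmap']
        refine (congrArg _ (ih' hxΛ hx)).trans ?_
        simp only [Finset.smul_sum, localCoeff_succ, smul_smul]
        refine Finset.sum_congr rfl fun n _ => Finset.sum_congr rfl fun σ _ => ?_
        rw [Equiv.prod_comp σ fun k => alpha (x k) (xi 0)]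
      · refine Eq.trans ?_ (Finset.sum_congr rfl fun n _ => (sum_perm_fin_succ fun s =>
          localCoeff xi alpha delta (Fin.cons 0 fun k => (n k).succ) (fun k => x (s k)) •
            (List.ofFn fun k => L ((Fin.cons 0 fun k => (n k).succ :
              Fin (m + 1) → Fin (N + 1)) k) (x (s k)) 0 1).prod v).symm)
        rw [Finset.sum_comm]
        refine Finset.sum_congr rfl fun i _ => ?_
        rw [herase, betheVec_map_univ]
        refine (congrArg (fun w => _ • L 0 (x i) 0 1 w) (ih' (fun k => hxΛ (i.succAbove k))
          (hx.comp i.succAbove_right_injective))).trans ?_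
        simp only [map_sum, Finset.smul_sum, map_smul, smul_smul]
        refine Finset.sum_congr rfl fun n _ => Finset.sum_congr rfl fun σ _ => ?_
        have hcons : (fun k => x ((Fin.cons i fun k => i.succAbove (σ k) :
            Fin (m + 1) → Fin (m + 1)) k)) = Fin.cons (x i) fun k => x (i.succAbove (σ k)) := by
          ext1 k
          refine Fin.cases ?_ (fun k => ?_) k <;> simp
        rw [hcons, localCoeff_cons, List.ofFn_succ, List.prod_cons, Module.End.mul_apply,
          Finset.prod_map, ← Equiv.prod_comp σ]
        simp

/-- local structure of formal Bethe vectors, XXX case.  The sum over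
`1 ≤ n₁ < ⋯ < n_M ≤ N` is encoded as a sum over strictly increasing maps
`n : Fin M → Fin N`. -/
theorem local_Bethe_vectors_XXX {H : Type} [AddCommGroup H] [Module ℂ H]
    (N : ℕ) (hN : 1 ≤ N) (xi : Fin N → ℂ) (Λ : Set ℂ)
    (L : Fin N → ℂ → Matrix (Fin 2) (Fin 2) (EndH H))
    (hRTT : ∀ j : Fin N, SatisfiesRTT Λ (fun lam mu => lam ≠ mu) RXXX (L j))
    (hcomm : ∀ i j : Fin N, i ≠ j → ∀ lam mu : ℂ, lam ∈ Λ → mu ∈ Λ →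
      ∀ a b c d : Fin 2, Commute (L i lam a b) (L j mu c d))
    (v0 : H) (hv0 : v0 ≠ 0) (alpha delta : ℂ → ℂ → ℂ)
    (hA : ∀ (j : Fin N) (lam : ℂ), lam ∈ Λ → L j lam 0 0 v0 = alpha lam (xi j) • v0)
    (hD : ∀ (j : Fin N) (lam : ℂ), lam ∈ Λ → L j lam 1 1 v0 = delta lam (xi j) • v0)
    (hC : ∀ (j : Fin N) (lam : ℂ), lam ∈ Λ → L j lam 1 0 v0 = 0)
    (hBB : ∀ (j : Fin N) (lam mu : ℂ), lam ∈ Λ → mu ∈ Λ →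
      (L j lam 0 1) ((L j mu 0 1) v0) = 0)
    (M : ℕ) (lam : Fin M → ℂ) (hlam : ∀ i, lam i ∈ Λ)
    (hdist : Function.Injective lam) :
    ((List.ofFn (fun i : Fin M =>
        (List.ofFn (fun j : Fin N => L j (lam i))).prod 0 1)).prod) v0
      = ∑ n ∈ Finset.univ.filter
            (fun n : Fin M → Fin N => ∀ k l : Fin M, k < l → n k < n l),
          ∑ σ : Equiv.Perm (Fin M),
            ((∏ l : Fin M,
                ((∏ i ∈ Finset.univ.filter (fun i : Fin N => i < n l),
                    alpha (lam (σ l)) (xi i)) *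
                  (∏ j ∈ Finset.univ.filter (fun j : Fin N => n l < j),
                    delta (lam (σ l)) (xi j)) *
                  (∏ r ∈ Finset.univ.filter (fun r : Fin M => l < r),
                    fXXX (lam (σ l)) (lam (σ r))))) •
              (((List.ofFn (fun k : Fin M => L (n k) (lam (σ k)) 0 1)).prod) v0)) := by
  exact prod_upperRight_apply_eq_sum hRTT hcomm hA hD hC hBB hlam hdist


end
end
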